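/- For g ∈ {4,5}, every g-minimal graph is 2-connected. -/

import Mathlib

open SimpleGraph

namespace InducedForest

/-- A graph is subcubic if every vertex has at most 3 neighbours. -/
def Subcubic {V : Type} (G : SimpleGraph V) : Prop := ∀ v : V, (G.neighborSet v).ncard ≤ 3

/-- A graph is cubic if every vertex has exactly 3 neighbours. -/
def Cubic {V : Type} (G : SimpleGraph V) : Prop := ∀ v : V, (G.neighborSet v).ncard = 3

/-- `S` is a feedback vertex set of `G` iff `G - S` is a forest. -/
def IsFVS {V : Type} (G : SimpleGraph V) (S : Set V) : Prop := (G.induce Sᶜ).IsAcyclic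

/-- `φ(G)`: the minimum size of a feedback vertex set of `G`. -/
noncomputable def fvs {V : Type} (G : SimpleGraph V) : ℕ :=
  sInf {n : ℕ | ∃ S : Set V, IsFVS G S ∧ S.ncard = n}

/-- `a(G)`: the maximum number of vertices of an induced forest in `G`. -/
noncomputable def indForestNum {V : Type} (G : SimpleGraph V) : ℕ :=
  sSup {n : ℕ | ∃ S : Set V, (G.induce S).IsAcyclic ∧ S.ncard = n}

/-- `v` is a cut-vertex of `G`: deleting it increases the number of connected components. -/
def IsCutVertex {V : Type} (G : SimpleGraph V) (v : V) : Prop :=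
  Nat.card G.ConnectedComponent < Nat.card (G.induce {u | u ≠ v}).ConnectedComponent

/-- `B` is a block of `G`: a maximal set of vertices inducing a connected subgraph
without cut-vertices. -/
def IsBlock {V : Type} (G : SimpleGraph V) (B : Set V) : Prop :=
  ((G.induce B).Connected ∧ ∀ v, ¬ IsCutVertex (G.induce B) v) ∧
  ∀ B' : Set V, B ⊆ B' →
    ((G.induce B').Connected ∧ ∀ v, ¬ IsCutVertex (G.induce B') v) → B' = B

/-- 2-connectedness: at least 3 vertices and removing fewer than 2 vertices
leaves a connected graph. -/
def TwoConnected {V : Type} (G : SimpleGraph V) : Prop :=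
  3 ≤ Nat.card V ∧ ∀ s : Set V, s.ncard < 2 → (G.induce sᶜ).Connected

/-- 3-connectedness: at least 4 vertices and removing fewer than 3 vertices
leaves a connected graph. -/
def ThreeConnected {V : Type} (G : SimpleGraph V) : Prop :=
  4 ≤ Nat.card V ∧ ∀ s : Set V, s.ncard < 3 → (G.induce sᶜ).Connected

/-- The graph obtained from `H` by subdividing the edge `xy` once;
the subdivision vertex is `none`. -/
def subdivide {V : Type} (H : SimpleGraph V) (x y : V) : SimpleGraph (Option V) :=
  SimpleGraph.fromRel (fun p q =>
    match p, q with
    | some u, some v => H.Adj u v ∧ s(u, v) ≠ s(x, y)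
    | some u, none => u = x ∨ u = y
    | _, _ => False)

/-- `G` is obtained from `H` by subdividing one edge once. -/
def IsSubdivisionOfOneEdge {V W : Type} (H : SimpleGraph V) (G : SimpleGraph W) : Prop :=
  ∃ x y : V, H.Adj x y ∧ Nonempty (G ≃g subdivide H x y)

/-- The graph obtained from `K` by adding one new vertex (`none`)
joined to all vertices of `S`. -/
def addApex {V : Type} (K : SimpleGraph V) (S : Set V) : SimpleGraph (Option V) :=
  SimpleGraph.fromRel (fun p q =>
    match p, q with
    | some u, some v => K.Adj u v
    | some u, none => u ∈ S
    | _, _ => False)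

/-- `G` is (isomorphic to) `H ∘ (e1, e2, a)`: subdivide `e1` and `e2` once each
(with `e1` subdivided twice if `e1 = e2`) and add a new vertex adjacent to `a` and to the
two subdivision vertices. -/
def IsCircOp {V W : Type} (H : SimpleGraph V) (e1 e2 : Sym2 V) (a : V)
    (G : SimpleGraph W) : Prop :=
  (e1 ≠ e2 ∧ ∃ x1 y1 x2 y2 : V, e1 = s(x1, y1) ∧ e2 = s(x2, y2) ∧
    Nonempty (G ≃g addApex (subdivide (subdivide H x1 y1) (some x2) (some y2))
      {some (some a), some none, none})) ∨
  (e1 = e2 ∧ ∃ x y : V, e1 = s(x, y) ∧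
    Nonempty (G ≃g addApex (subdivide (subdivide H x y) none (some y))
      {some (some a), some none, none}))

/-- The cycle of length `n` (for `n ≥ 3`). -/
def cyc (n : ℕ) : SimpleGraph (ZMod n) :=
  SimpleGraph.fromRel (fun u v => v = u + 1)

/-- The families `F_{i,j}` of graphs (closed under isomorphism):
`F_{i,0} = {C_i}` for `i ≥ 3`; `F_{1,1} = {K_4}`; `F_{j,j}` for `j ≥ 2` is obtained from
`F_{j-1,j-1}` by subdividing one edge once and then applying the `∘` operation at the
subdivision vertex; and `F_{i,j}` for `i > j ≥ 1` is obtained from `F_{j,j}` by `i - j`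
successive single-edge subdivisions. -/
inductive MemF : ℕ → ℕ → ∀ {V : Type}, SimpleGraph V → Prop
  | cycle {i : ℕ} (hi : 3 ≤ i) {V : Type} {G : SimpleGraph V}
      (h : Nonempty (G ≃g cyc i)) : MemF i 0 G
  | k4 {V : Type} {G : SimpleGraph V}
      (h : Nonempty (G ≃g (⊤ : SimpleGraph (Fin 4)))) : MemF 1 1 G
  | circ {j : ℕ} (hj : 2 ≤ j) {V : Type} {H : SimpleGraph V}
      (hH : MemF (j - 1) (j - 1) H) {x y : V} (hxy : H.Adj x y)
      {e1 e2 : Sym2 (Option V)} (he1 : e1 ∈ (subdivide H x y).edgeSet)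
      (he2 : e2 ∈ (subdivide H x y).edgeSet)
      {W : Type} {G : SimpleGraph W}
      (hG : IsCircOp (subdivide H x y) e1 e2 none G) : MemF j j G
  | subd {i j : ℕ} (hj : 1 ≤ j) {V : Type} {H : SimpleGraph V}
      (hH : MemF i j H) {x y : V} (hxy : H.Adj x y) {W : Type} {G : SimpleGraph W}
      (hG : Nonempty (G ≃g subdivide H x y)) : MemF (i + 1) j G

/-- `K_4^+`: the graph obtained from `K_4` by subdividing one edge once. -/
def K4plus : SimpleGraph (Option (Fin 4)) :=
  subdivide (⊤ : SimpleGraph (Fin 4)) 0 1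

/-- `L`: the graph obtained from `K_4` by subdividing once each edge
of a perfect matching. -/
def Lgraph : SimpleGraph (Option (Option (Fin 4))) :=
  subdivide (subdivide (⊤ : SimpleGraph (Fin 4)) 0 1) (some 2) (some 3)

/-- The Petersen graph. -/
def petersen : SimpleGraph (ZMod 5 × Fin 2) :=
  SimpleGraph.fromRel (fun u v =>
    (u.2 = 0 ∧ v.2 = 0 ∧ v.1 = u.1 + 1) ∨
    (u.2 = 1 ∧ v.2 = 1 ∧ v.1 = u.1 + 2) ∨
    (u.2 = 0 ∧ v.2 = 1 ∧ u.1 = v.1))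

/-- `R`: the Petersen graph minus one edge. -/
def Rgraph : SimpleGraph (ZMod 5 × Fin 2) :=
  petersen.deleteEdges {s(((0 : ZMod 5), (0 : Fin 2)), ((1 : ZMod 5), (0 : Fin 2)))}

/-- `Q_3`: the 3-dimensional cube graph. -/
def Q3 : SimpleGraph (Fin 2 × Fin 2 × Fin 2) :=
  SimpleGraph.fromRel (fun u v =>
    (u.1 ≠ v.1 ∧ u.2 = v.2) ∨ (u.1 = v.1 ∧ u.2.1 ≠ v.2.1 ∧ u.2.2 = v.2.2) ∨
    (u.1 = v.1 ∧ u.2.1 = v.2.1 ∧ u.2.2 ≠ v.2.2))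

/-- `V_8`: the Wagner graph. -/
def V8 : SimpleGraph (ZMod 8) :=
  SimpleGraph.fromRel (fun u v => v = u + 1 ∨ v = u + 4)

/-- The dodecahedron, presented as the generalized Petersen graph `GP(10,2)`. -/
def dodecahedron : SimpleGraph (ZMod 10 × Fin 2) :=
  SimpleGraph.fromRel (fun u v =>
    (u.2 = 0 ∧ v.2 = 0 ∧ v.1 = u.1 + 1) ∨
    (u.2 = 1 ∧ v.2 = 1 ∧ v.1 = u.1 + 2) ∨
    (u.2 = 0 ∧ v.2 = 1 ∧ u.1 = v.1))

/-- The families `F^g_{i,j,k}`: 2-connected subcubic graphs obtained from the disjoint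
union of `k` copies of `L` (when `g = 4`) or of `R` (when `g = 5`) and one member of
`F_{i,j}` by adding `k+1` edges; when `k ≥ 1`, each added edge joins two different
constituent copies. -/
def MemFG (g i j k : ℕ) {W : Type} (G : SimpleGraph W) : Prop :=
  TwoConnected G ∧ Subcubic G ∧
  ∃ (P : W → Fin (k + 1)) (H : SimpleGraph W),
    H ≤ G ∧ (∀ u v, H.Adj u v → P u = P v) ∧
    MemF i j (H.induce (P ⁻¹' {0})) ∧
    ((g = 4 ∧ ∀ l : Fin (k + 1), l ≠ 0 → Nonempty ((H.induce (P ⁻¹' {l})) ≃g Lgraph)) ∨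
     (g = 5 ∧ ∀ l : Fin (k + 1), l ≠ 0 → Nonempty ((H.induce (P ⁻¹' {l})) ≃g Rgraph))) ∧
    (G.edgeSet \ H.edgeSet).ncard = k + 1 ∧
    (1 ≤ k → ∀ u v, G.Adj u v → ¬ H.Adj u v → P u ≠ P v)

/-- `t_4 = 2/9`, `t_5 = 1/5`. -/
noncomputable def tg (g : ℕ) : ℝ := if g = 4 then 2 / 9 else 1 / 5

/-- The error function `ε_g` on graphs. -/
noncomputable def eps (g : ℕ) {V : Type} (G : SimpleGraph V) : ℝ := by
  classical
  exact
    if h1 : ∃ p : ℕ × ℕ, 1 ≤ p.1 ∧ p.2 ≤ p.1 ∧ MemF p.1 p.2 G then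
      max (1 - (h1.choose.2 : ℝ) * (5 * tg g - 1) - (h1.choose.1 : ℝ) * tg g) 0
    else if h2 : ∃ q : ℕ × ℕ × ℕ, 1 ≤ q.1 ∧ q.2.1 ≤ q.1 ∧ MemFG g q.1 q.2.1 q.2.2 G then
      max (1 - tg g - (h2.choose.2.1 : ℝ) * (5 * tg g - 1) - (h2.choose.1 : ℝ) * tg g) 0
    else if Nonempty (G ≃g (⊤ : SimpleGraph (Fin 2))) then -tg g
    else 0

/-- The error function `r_g(G)`: the sum of `ε_g(B)` over all blocks `B` of `G`. -/
noncomputable def rg (g : ℕ) {V : Type} (G : SimpleGraph V) : ℝ :=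
  ∑ᶠ B ∈ {B : Set V | IsBlock G B}, eps g (G.induce B)

/-- `G` has two vertex-disjoint cycles, each of length less than `g`. -/
def TwoDisjointCyclesLt {V : Type} (G : SimpleGraph V) (g : ℕ) : Prop :=
  ∃ (u v : V) (c1 : G.Walk u u) (c2 : G.Walk v v), c1.IsCycle ∧ c2.IsCycle ∧
    c1.length < g ∧ c2.length < g ∧ ∀ x, x ∈ c1.support → x ∉ c2.support

/-- `G` contains a (not necessarily induced) subgraph isomorphic to `K`. -/
def ContainsSubgraphCopy {U V : Type} (K : SimpleGraph U) (G : SimpleGraph V) : Prop :=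
  ∃ f : U → V, Function.Injective f ∧ ∀ u v, K.Adj u v → G.Adj (f u) (f v)

/-- `G` is obtained from `H` by adding edges, each of which is a cut-edge of `G`. -/
def AddCutEdges {V : Type} (H G : SimpleGraph V) : Prop :=
  H ≤ G ∧ ∀ e ∈ G.edgeSet \ H.edgeSet, G.IsBridge e

/-- The edges of `H` all lie inside the parts of the partition given by `P`. -/
def PartitionedBy {V ι : Type} (H : SimpleGraph V) (P : V → ι) : Prop :=
  ∀ u v, H.Adj u v → P u = P v

/-- `G` is `g`-minimal: a minimum counterexample to the main theorem. -/
def GMinimal (g : ℕ) {V : Type} [Fintype V] (G : SimpleGraph V) : Prop :=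
  Subcubic G ∧ ¬ TwoDisjointCyclesLt G g ∧
  tg g * G.edgeSet.ncard + rg g G < (fvs G : ℝ) ∧
  ∀ (W : Type) [Fintype W] (H : SimpleGraph W), Nat.card W < Nat.card V →
    Subcubic H → ¬ TwoDisjointCyclesLt H g →
    (fvs H : ℝ) ≤ tg g * H.edgeSet.ncard + rg g H

/-! ### Isomorphism invariance -/

/-- Restriction of an isomorphism to matching vertex sets. -/
def isoInd {V W : Type} {G : SimpleGraph V} {G' : SimpleGraph W} (e : G ≃g G')
    (s : Set V) (t : Set W) (h : ∀ x, x ∈ s ↔ e x ∈ t) : G.induce s ≃g G'.induce t where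
  toEquiv := e.toEquiv.subtypeEquiv h
  map_rel_iff' := by
    intro a b
    exact e.map_adj_iff

lemma MemF.iso {i j : ℕ} {V W : Type} {G : SimpleGraph V} {G' : SimpleGraph W}
    (e : G ≃g G') (h : MemF i j G) : MemF i j G' := by
  cases h with
  | cycle hi h => exact .cycle hi (h.map fun f => e.symm.trans f)
  | k4 h => exact .k4 (h.map fun f => e.symm.trans f)
  | circ hj hH hxy he1 he2 hG =>
    refine .circ hj hH hxy he1 he2 ?_
    rcases hG with ⟨h, x1, y1, x2, y2, h1, h2, h3⟩ | ⟨h, x, y, h1, h3⟩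
    · exact Or.inl ⟨h, x1, y1, x2, y2, h1, h2, h3.map fun f => e.symm.trans f⟩
    · exact Or.inr ⟨h, x, y, h1, h3.map fun f => e.symm.trans f⟩
  | subd hj hH hxy hG => exact .subd hj hH hxy (hG.map fun f => e.symm.trans f)

lemma MemF.three {i j : ℕ} {V : Type} {G : SimpleGraph V} (h : MemF i j G) :
    Nonempty (Fin 3 ↪ V) := by
  induction h with
  | @cycle i hi V G h =>
    obtain ⟨f⟩ := h
    have : NeZero i := ⟨by omega⟩
    have hc : Fintype.card (Fin 3) ≤ Fintype.card (ZMod i) := by simpa [ZMod.card] using hi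
    obtain ⟨k⟩ := Function.Embedding.nonempty_of_card_le hc
    exact ⟨k.trans f.symm.toEquiv.toEmbedding⟩
  | k4 h =>
    obtain ⟨f⟩ := h
    exact ⟨Fin.castSuccEmb.trans f.symm.toEquiv.toEmbedding⟩
  | circ hj hH hxy he1 he2 hG ih =>
    obtain ⟨k⟩ := ih
    have k' := (((k.trans Function.Embedding.some).trans Function.Embedding.some).trans
      Function.Embedding.some).trans Function.Embedding.some
    rcases hG with ⟨h, x1, y1, x2, y2, h1, h2, ⟨f⟩⟩ | ⟨h, x, y, h1, ⟨f⟩⟩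
    · exact ⟨k'.trans f.symm.toEquiv.toEmbedding⟩
    · exact ⟨k'.trans f.symm.toEquiv.toEmbedding⟩
  | subd hj hH hxy hG ih =>
    obtain ⟨k⟩ := ih
    obtain ⟨f⟩ := hG
    exact ⟨(k.trans Function.Embedding.some).trans f.symm.toEquiv.toEmbedding⟩

lemma MemF.card {i j : ℕ} {V : Type} [Finite V] {G : SimpleGraph V} (h : MemF i j G) :
    3 ≤ Nat.card V := by
  obtain ⟨k⟩ := h.three
  simpa using Nat.card_le_card_of_injective k k.injective

lemma TwoConnected.iso {V W : Type} {G : SimpleGraph V} {G' : SimpleGraph W}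
    (e : G ≃g G') (h : TwoConnected G) : TwoConnected G' := by
  refine ⟨by rw [← Nat.card_congr e.toEquiv]; exact h.1, fun s hs => ?_⟩
  have h2 := h.2 (e ⁻¹' s) (by
    rw [Set.ncard_preimage_of_injective_subset_range e.injective
      (by rw [e.surjective.range_eq]; exact Set.subset_univ _)]
    exact hs)
  exact (isoInd e (e ⁻¹' s)ᶜ sᶜ (fun x => Iff.rfl)).connected_iff.1 h2

lemma Subcubic.iso {V W : Type} {G : SimpleGraph V} {G' : SimpleGraph W}
    (e : G ≃g G') (h : Subcubic G) : Subcubic G' := by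
  intro v
  have h2 := h (e.symm v)
  have : G'.neighborSet v = e '' G.neighborSet (e.symm v) := by
    ext x
    simp only [mem_neighborSet, Set.mem_image]
    constructor
    · intro hx
      exact ⟨e.symm x, e.symm.map_adj_iff.2 hx, by simp⟩
    · rintro ⟨y, hy, rfl⟩
      have := e.map_adj_iff.2 hy
      simpa using this
  rw [this, Set.ncard_image_of_injective _ e.injective]
  exact h2

lemma MemFG.iso {g i j k : ℕ} {V W : Type} {G : SimpleGraph V} {G' : SimpleGraph W}
    (e : G ≃g G') (h : MemFG g i j k G) : MemFG g i j k G' := by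
  obtain ⟨h1, h2, P, H, h3, h4, h5, h6, h7, h8⟩ := h
  let H' : SimpleGraph W := H.comap e.symm
  let f : H ≃g H' :=
    { toEquiv := e.toEquiv
      map_rel_iff' := by
        intro a b
        change H.Adj (e.symm (e a)) (e.symm (e b)) ↔ _
        simp }
  have fi : ∀ l, H.induce (P ⁻¹' {l}) ≃g H'.induce ((P ∘ e.symm) ⁻¹' {l}) := fun l =>
    isoInd f _ _ (fun x => by
      change P x = l ↔ P (e.symm (e x)) = l
      simp)
  refine ⟨h1.iso e, h2.iso e, P ∘ e.symm, H', ?_, ?_, ?_, ?_, ?_, ?_⟩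
  · intro a b hab
    exact e.symm.map_adj_iff.1 (h3 hab)
  · intro u v huv
    exact h4 _ _ huv
  · exact h5.iso (fi 0)
  · rcases h6 with ⟨hg, h6⟩ | ⟨hg, h6⟩
    · exact Or.inl ⟨hg, fun l hl => (h6 l hl).map fun q => (fi l).symm.trans q⟩
    · exact Or.inr ⟨hg, fun l hl => (h6 l hl).map fun q => (fi l).symm.trans q⟩
  · rw [← h7]
    have : G'.edgeSet \ H'.edgeSet = Sym2.map e '' (G.edgeSet \ H.edgeSet) := by
      ext x
      induction x with | _ a b
      constructor
      · rintro ⟨ha, hb⟩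
        exact ⟨s(e.symm a, e.symm b), ⟨e.symm.map_adj_iff.2 ha, hb⟩, by simp⟩
      · rintro ⟨y, ⟨ha, hb⟩, hy⟩
        induction y with | _ c d
        rw [← hy]
        exact ⟨e.map_adj_iff.2 ha, fun hc => hb (f.map_adj_iff.1 hc)⟩
    rw [this, Set.ncard_image_of_injective _ (Sym2.map.injective e.injective)]
  · intro hk u v huv hn
    exact h8 hk _ _ (e.symm.map_adj_iff.2 huv) hn

open Classical in
/-- The value of `eps` in terms of the membership predicates. -/
noncomputable def epsAux (g : ℕ) (P : ℕ × ℕ → Prop) (Q : ℕ × ℕ × ℕ → Prop) (K : Prop) : ℝ :=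
  if h1 : ∃ p, P p then
    max (1 - (h1.choose.2 : ℝ) * (5 * tg g - 1) - (h1.choose.1 : ℝ) * tg g) 0
  else if h2 : ∃ q, Q q then
    max (1 - tg g - (h2.choose.2.1 : ℝ) * (5 * tg g - 1) - (h2.choose.1 : ℝ) * tg g) 0
  else if K then -tg g
  else 0

lemma eps_eq_aux (g : ℕ) {V : Type} (G : SimpleGraph V) :
    eps g G = epsAux g (fun p => 1 ≤ p.1 ∧ p.2 ≤ p.1 ∧ MemF p.1 p.2 G)
      (fun q => 1 ≤ q.1 ∧ q.2.1 ≤ q.1 ∧ MemFG g q.1 q.2.1 q.2.2 G)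
      (Nonempty (G ≃g (⊤ : SimpleGraph (Fin 2)))) := rfl

lemma eps_iso (g : ℕ) {V W : Type} {G : SimpleGraph V} {G' : SimpleGraph W}
    (e : G ≃g G') : eps g G = eps g G' := by
  have h1 : ∀ i j, MemF i j G = MemF i j G' := fun i j =>
    propext ⟨MemF.iso e, MemF.iso e.symm⟩
  have h2 : ∀ i j k, MemFG g i j k G = MemFG g i j k G' := fun i j k =>
    propext ⟨MemFG.iso e, MemFG.iso e.symm⟩
  have h3 : Nonempty (G ≃g (⊤ : SimpleGraph (Fin 2))) =
      Nonempty (G' ≃g (⊤ : SimpleGraph (Fin 2))) :=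
    propext ⟨fun h => h.map e.symm.trans, fun h => h.map e.trans⟩
  rw [eps_eq_aux, eps_eq_aux]
  simp only [h1, h2, h3]

lemma eps_small (g : ℕ) {V : Type} [Finite V] {G : SimpleGraph V} (h : Nat.card V ≤ 2) :
    eps g G = open Classical in
      if Nonempty (G ≃g (⊤ : SimpleGraph (Fin 2))) then -tg g else 0 := by
  unfold eps
  rw [dif_neg, dif_neg]
  · rintro ⟨q, _, _, h3⟩
    have := h3.1.1
    omega
  · rintro ⟨q, _, _, h3⟩
    have := h3.card
    omega

lemma eps_subsingleton (g : ℕ) {V : Type} [Finite V] {G : SimpleGraph V} (h : Nat.card V ≤ 1) :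
    eps g G = 0 := by
  rw [eps_small g (by omega), if_neg]
  rintro ⟨f⟩
  have := Nat.card_congr f.toEquiv
  simp at this
  omega

lemma eps_K2 (g : ℕ) {V : Type} [Finite V] {G : SimpleGraph V} {u v : V} (huv : G.Adj u v)
    (h : ∀ w, w = u ∨ w = v) : eps g G = -tg g := by
  have hc : Nat.card V = 2 := by
    rw [Nat.card_eq_two_iff]
    exact ⟨u, v, huv.ne, by ext w; simpa using h w⟩
  rw [eps_small g hc.le, if_pos]
  have hG : G = ⊤ := by
    ext a b
    rw [top_adj]
    refine ⟨fun hab => hab.ne, fun hab => ?_⟩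
    rcases h a with rfl | rfl <;> rcases h b with rfl | rfl
    · exact absurd rfl hab
    · exact huv
    · exact huv.symm
    · exact absurd rfl hab
  subst hG
  exact ⟨Iso.completeGraph (Finite.equivFinOfCardEq hc)⟩

/-- connected without cut-vertices -/
def GoodGraph {V : Type} (G : SimpleGraph V) : Prop :=
  G.Connected ∧ ∀ v, ¬ IsCutVertex G v

lemma GoodGraph.iso {V W : Type} {G : SimpleGraph V} {G' : SimpleGraph W}
    (e : G ≃g G') (h : GoodGraph G) : GoodGraph G' := by
  refine ⟨e.connected_iff.1 h.1, fun v hv => h.2 (e.symm v) ?_⟩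
  unfold IsCutVertex at *
  rw [Nat.card_congr e.connectedComponentEquiv]
  refine lt_of_lt_of_eq hv ?_
  refine Nat.card_congr (Iso.connectedComponentEquiv (isoInd e.symm _ _ fun x => ?_))
  simp

/-! ### Cuts with at most one edge -/

/-- at most one edge between `A` and its complement -/
def Cut1 {V : Type} (G : SimpleGraph V) (A : Set V) : Prop :=
  ∀ x ∈ A, ∀ y ∉ A, ∀ x' ∈ A, ∀ y' ∉ A, G.Adj x y → G.Adj x' y' → x = x' ∧ y = y'

lemma Cut1.compl {V : Type} {G : SimpleGraph V} {A : Set V} (h : Cut1 G A) : Cut1 G Aᶜ := by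
  intro x hx y hy x' hx' y' hy' h1 h2
  exact (h y (by simpa using hy) x hx y' (by simpa using hy') x' hx' h1.symm h2.symm).symm

lemma Cut1.induce {V : Type} {G : SimpleGraph V} {A : Set V} (h : Cut1 G A) (B : Set V) :
    Cut1 (G.induce B) (Subtype.val ⁻¹' A) := by
  intro x hx y hy x' hx' y' hy' h1 h2
  have := h x hx y hy x' hx' y' hy' h1 h2
  exact ⟨Subtype.ext this.1, Subtype.ext this.2⟩

lemma Cut1.cutVertex {V : Type} [Finite V] {G : SimpleGraph V} {A : Set V} (h : Cut1 G A)
    (hc : G.Connected) {u v w : V} (hu : u ∈ A) (hv : v ∉ A) (huv : G.Adj u v)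
    (hw : w ∈ A) (hwu : w ≠ u) : IsCutVertex G u := by
  unfold IsCutVertex
  have : Subsingleton G.ConnectedComponent := hc.preconnected.subsingleton_connectedComponent
  have hvu : v ≠ u := fun hh => hv (hh ▸ hu)
  refine lt_of_le_of_lt (Finite.card_le_one_iff_subsingleton.2 this) ?_
  rw [Finite.one_lt_card_iff_nontrivial]
  refine ⟨⟨connectedComponentMk _ ⟨w, hwu⟩, connectedComponentMk _ ⟨v, hvu⟩, fun heq => ?_⟩⟩
  obtain ⟨p⟩ := ConnectedComponent.exact heq
  obtain ⟨d, -, h1, h2⟩ := p.exists_boundary_dart (Subtype.val ⁻¹' A) hw hv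
  have := h _ h1 _ h2 _ hu _ hv d.adj huv
  exact d.fst.2 this.1

lemma Cut1.good {V : Type} [Finite V] {G : SimpleGraph V} {A : Set V} (h : Cut1 G A)
    (hg : GoodGraph G) {a b : V} (ha : a ∈ A) (hb : b ∉ A) :
    ∃ u ∈ A, ∃ v ∉ A, G.Adj u v ∧ ∀ w, w = u ∨ w = v := by
  obtain ⟨p⟩ := hg.1.preconnected a b
  obtain ⟨d, -, h1, h2⟩ := p.exists_boundary_dart A ha hb
  refine ⟨d.fst, h1, d.snd, h2, d.adj, fun w => ?_⟩
  by_contra! hw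
  by_cases hwA : w ∈ A
  · exact hg.2 _ (h.cutVertex hg.1 h1 h2 d.adj hwA hw.1)
  · exact hg.2 _ (h.compl.cutVertex hg.1 h2 (by simpa using h1) d.adj.symm hwA hw.2)

lemma good_pair {V : Type} [Finite V] {G : SimpleGraph V} {u v : V} (huv : G.Adj u v)
    (h : ∀ w, w = u ∨ w = v) : GoodGraph G := by
  have hne : Nonempty V := ⟨u⟩
  have hc : G.Connected := by
    refine ⟨fun a b => ?_⟩
    rcases h a with rfl | rfl <;> rcases h b with rfl | rfl
    · exact Reachable.refl _
    · exact huv.reachable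
    · exact huv.symm.reachable
    · exact Reachable.refl _
  refine ⟨hc, fun x hx => ?_⟩
  unfold IsCutVertex at hx
  have h1 : 0 < Nat.card G.ConnectedComponent := Finite.card_pos_iff.2 ⟨G.connectedComponentMk u⟩
  have h3 : Subsingleton ({w | w ≠ x} : Set V) := by
    refine ⟨fun a b => Subtype.ext ?_⟩
    have := a.2; have := b.2
    have := h a; have := h b; have := h x
    simp only [Set.mem_ofPred_eq] at *
    grind
  have h2 : Nat.card (G.induce {w | w ≠ x}).ConnectedComponent ≤ 1 := by
    rw [Finite.card_le_one_iff_subsingleton]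
    exact (Quot.mk_surjective).subsingleton
  omega

lemma Cut1.acyclic {V : Type} {G : SimpleGraph V} {A : Set V} (h : Cut1 G A)
    (h1 : (G.induce A).IsAcyclic) (h2 : (G.induce Aᶜ).IsAcyclic) : G.IsAcyclic := by
  classical
  intro u c hc
  wlog hu : u ∈ A generalizing A
  · exact this (A := Aᶜ) h.compl h2 (by rwa [compl_compl]) hu
  by_cases hs : ∀ x ∈ c.support, x ∈ A
  · apply h1 (c.induce A hs)
    rw [← Walk.isCycle_map_iff_of_injective (f := (Embedding.induce A).toHom)
      (Embedding.induce (G := G) A).injective, Walk.map_induce]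
    exact hc
  · push Not at hs
    obtain ⟨x, hx, hxA⟩ := hs
    obtain ⟨d, hd, hd1, hd2⟩ := (c.takeUntil x hx).exists_boundary_dart A hu hxA
    have he : d.edge ∈ c.edges :=
      Walk.edges_takeUntil_subset_edges _ hx (List.mem_map_of_mem hd)
    refine (isBridge_iff_forall_cycle_notMem d.edge_mem).1 ?_ c hc he
    change G.IsBridge s(d.fst, d.snd)
    rw [isBridge_iff_forall_walk_mem_edges]
    intro p
    obtain ⟨d', hdp, h3, h4⟩ := p.exists_boundary_dart A hd1 hd2
    obtain ⟨e1, e2⟩ := h _ hd1 _ hd2 _ h3 _ h4 d.adj d'.adj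
    have e3 : s(d.fst, d.snd) = d'.edge := by
      change _ = s(d'.fst, d'.snd)
      rw [e1, e2]
    rw [e3]
    exact List.mem_map_of_mem hdp

/-! ### Feedback vertex sets -/

lemma fvs_le {V : Type} {G : SimpleGraph V} {S : Set V} (h : IsFVS G S) : fvs G ≤ S.ncard :=
  Nat.sInf_le ⟨S, h, rfl⟩

lemma exists_fvs {V : Type} (G : SimpleGraph V) : ∃ S : Set V, IsFVS G S ∧ S.ncard = fvs G := by
  have : {n : ℕ | ∃ S : Set V, IsFVS G S ∧ S.ncard = n}.Nonempty := by
    refine ⟨_, Set.univ, ?_, rfl⟩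
    have : Subsingleton ((Set.univ : Set V)ᶜ : Set V) := ⟨fun a => absurd trivial a.2⟩
    exact IsAcyclic.of_subsingleton
  exact Nat.sInf_mem this

lemma acyclic_part {V : Type} {G : SimpleGraph V} {A S : Set V} {T : Set A} (hT : IsFVS (G.induce A) T)
    (hTS : ∀ x : A, x ∈ T → (x : V) ∈ S) :
    ((G.induce Sᶜ).induce (Subtype.val ⁻¹' A)).IsAcyclic := by
  let f : ((G.induce Sᶜ).induce (Subtype.val ⁻¹' A)) →g ((G.induce A).induce Tᶜ) :=
    { toFun := fun x => ⟨⟨x.1.1, x.2⟩, fun hx => x.1.2 (hTS _ hx)⟩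
      map_rel' := fun h => h }
  refine IsAcyclic.comap f ?_ hT
  intro x y hxy
  have := congrArg (fun z => z.1.1) hxy
  exact Subtype.ext (Subtype.ext this)

lemma Cut1.fvs_le {V : Type} [Finite V] {G : SimpleGraph V} {A : Set V} (h : Cut1 G A) :
    fvs G ≤ fvs (G.induce A) + fvs (G.induce Aᶜ) := by
  obtain ⟨S, hS, hS'⟩ := exists_fvs (G.induce A)
  obtain ⟨T, hT, hT'⟩ := exists_fvs (G.induce Aᶜ)
  have hF : IsFVS G (Subtype.val '' S ∪ Subtype.val '' T) := by
    refine (h.induce _).acyclic (acyclic_part hS ?_) ?_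
    · intro x hx
      exact Or.inl ⟨x, hx, rfl⟩
    · have := acyclic_part (S := Subtype.val '' S ∪ Subtype.val '' T) hT
        (fun x hx => Or.inr ⟨x, hx, rfl⟩)
      exact this
  refine (InducedForest.fvs_le hF).trans ((Set.ncard_union_le _ _).trans ?_)
  rw [← hS', ← hT', Set.ncard_image_of_injective _ Subtype.val_injective,
    Set.ncard_image_of_injective _ Subtype.val_injective]

/-! ### Edges -/

lemma edges_add {V : Type} [Finite V] (G : SimpleGraph V) (A : Set V) (C : Set (Sym2 V))
    (hC : ∀ e ∈ C, ∃ x ∈ A, ∃ y ∉ A, G.Adj x y ∧ e = s(x, y)) :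
    (G.induce A).edgeSet.ncard + (G.induce Aᶜ).edgeSet.ncard + C.ncard ≤ G.edgeSet.ncard := by
  have key : ∀ B : Set V, ∀ e ∈ (Sym2.map Subtype.val '' (G.induce B).edgeSet),
      e ∈ G.edgeSet ∧ ∀ x ∈ e, x ∈ B := by
    rintro B _ ⟨e, he, rfl⟩
    induction e with | _ a b
    refine ⟨he, ?_⟩
    intro x hx
    rw [Sym2.map_mk, Sym2.mem_iff] at hx
    rcases hx with rfl | rfl
    · exact a.2
    · exact b.2
  have d1 : Disjoint (Sym2.map Subtype.val '' (G.induce A).edgeSet)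
      (Sym2.map Subtype.val '' (G.induce Aᶜ).edgeSet) := by
    rw [Set.disjoint_left]
    intro e h1 h2
    have k1 := (key _ e h1).2
    have k2 := (key _ e h2).2
    induction e with | _ a b
    exact k2 a (Sym2.mem_mk_left _ _) (k1 a (Sym2.mem_mk_left _ _))
  have d2 : Disjoint (Sym2.map Subtype.val '' (G.induce A).edgeSet ∪
      Sym2.map Subtype.val '' (G.induce Aᶜ).edgeSet) C := by
    rw [Set.disjoint_left]
    intro e h1 h2
    obtain ⟨x, hx, y, hy, -, rfl⟩ := hC e h2
    rcases h1 with h1 | h1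
    · exact hy ((key _ _ h1).2 y (Sym2.mem_mk_right _ _))
    · exact (key _ _ h1).2 x (Sym2.mem_mk_left _ _) hx
  rw [← Set.ncard_image_of_injective (G.induce A).edgeSet
      (Sym2.map.injective Subtype.val_injective),
    ← Set.ncard_image_of_injective (G.induce Aᶜ).edgeSet
      (Sym2.map.injective Subtype.val_injective),
    ← Set.ncard_union_eq d1 (Set.toFinite _) (Set.toFinite _),
    ← Set.ncard_union_eq d2 (Set.toFinite _) (Set.toFinite _)]
  apply Set.ncard_le_ncard _ (Set.toFinite _)
  rintro e ((he | he) | he)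
  · exact (key _ e he).1
  · exact (key _ e he).1
  · obtain ⟨x, hx, y, hy, hxy, rfl⟩ := hC e he
    exact hxy

/-! ### Blocks -/

lemma isBlock_iff {V : Type} {G : SimpleGraph V} {B : Set V} : IsBlock G B ↔
    GoodGraph (G.induce B) ∧ ∀ B', B ⊆ B' → GoodGraph (G.induce B') → B' = B := Iff.rfl

/-- The nontrivial blocks. -/
def NBlocks {V : Type} (G : SimpleGraph V) : Set (Set V) := {B | IsBlock G B ∧ B.Nontrivial}

lemma rg_eq {V : Type} [Finite V] (g : ℕ) (G : SimpleGraph V) :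
    rg g G = ∑ᶠ B ∈ NBlocks G, eps g (G.induce B) := by
  unfold rg
  apply finsum_mem_inter_support_eq'
  intro B hB
  refine ⟨fun h => ⟨h, ?_⟩, fun h => h.1⟩
  by_contra hn
  rw [Set.not_nontrivial_iff] at hn
  apply hB
  apply eps_subsingleton
  rw [Finite.card_le_one_iff_subsingleton]
  exact hn.coe_sort

/-- An induced subgraph of an induced subgraph. -/
noncomputable def isoSub {V : Type} (G : SimpleGraph V) (A : Set V) (B : Set A) :
    (G.induce A).induce B ≃g G.induce (Subtype.val '' B) where
  toEquiv := Equiv.Set.image _ B Subtype.val_injective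
  map_rel_iff' := Iff.rfl

lemma Cut1.good_cross {V : Type} [Finite V] {G : SimpleGraph V} {A B : Set V} (h : Cut1 G A)
    (hg : GoodGraph (G.induce B)) (h1 : ¬ B ⊆ A) (h2 : ¬ B ⊆ Aᶜ) :
    ∃ x ∈ A, ∃ y ∉ A, G.Adj x y ∧ B = {x, y} := by
  rw [Set.not_subset] at h1 h2
  obtain ⟨b, hb, hb'⟩ := h1
  obtain ⟨a, ha, ha'⟩ := h2
  obtain ⟨u, hu, v, hv, huv, hw⟩ := (h.induce B).good hg (a := ⟨a, ha⟩) (b := ⟨b, hb⟩)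
    (not_not.1 ha') hb'
  refine ⟨u, hu, v, hv, huv, ?_⟩
  ext x
  constructor
  · intro hx
    rcases hw ⟨x, hx⟩ with rfl | rfl <;> simp
  · rintro (rfl | rfl)
    · exact u.2
    · exact v.2

lemma good_induce_pair {V : Type} [Finite V] {G : SimpleGraph V} {u v : V} (h : G.Adj u v) :
    GoodGraph (G.induce {u, v}) := by
  refine good_pair (u := ⟨u, by simp⟩) (v := ⟨v, by simp⟩) h ?_
  rintro ⟨w, rfl | rfl⟩ <;> simp

/-- Blocks inside a side of the cut. -/
lemma block_down {V : Type} {G : SimpleGraph V} {A B : Set V} (hB : B ∈ NBlocks G) (hBA : B ⊆ A) :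
    B ∈ (fun B : Set A => (Subtype.val '' B : Set V)) '' NBlocks (G.induce A) := by
  have e : (Subtype.val '' (Subtype.val ⁻¹' B : Set A) : Set V) = B := by
    rw [Subtype.image_preimage_coe]
    exact Set.inter_eq_right.2 hBA
  refine ⟨Subtype.val ⁻¹' B, ⟨⟨?_, ?_⟩, ?_⟩, e⟩
  · have h := (isBlock_iff.1 hB.1).1
    rw [← e] at h
    exact h.iso (isoSub G A _).symm
  · intro B' hs hg
    have h := (isBlock_iff.1 hB.1).2 (Subtype.val '' B')
      (by rw [← e]; exact Set.image_mono hs) (GoodGraph.iso (isoSub G A B') hg)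
    rw [← h, Set.preimage_image_eq _ Subtype.val_injective]
  · have h := hB.2
    rw [← e] at h
    obtain ⟨_, ⟨a, ha, rfl⟩, _, ⟨b, hb, rfl⟩, hab⟩ := h
    exact ⟨a, ha, b, hb, fun hh => hab (by rw [hh])⟩

lemma Cut1.block_up {V : Type} [Finite V] {G : SimpleGraph V} {A : Set V} (h : Cut1 G A) {B : Set A}
    (hB : B ∈ NBlocks (G.induce A)) : (Subtype.val '' B : Set V) ∈ NBlocks G := by
  refine ⟨isBlock_iff.2 ⟨GoodGraph.iso (isoSub G A B) hB.1.1, ?_⟩,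
    hB.2.image Subtype.val_injective⟩
  intro B' hs hg
  obtain ⟨a, ha, b, hb, hab⟩ := hB.2
  have hab' : (a : V) ≠ b := fun hh => hab (Subtype.ext hh)
  have ha' : (a : V) ∈ B' := hs ⟨a, ha, rfl⟩
  have hb' : (b : V) ∈ B' := hs ⟨b, hb, rfl⟩
  have hBA : B' ⊆ A := by
    by_contra hn
    obtain ⟨x, hx, y, hy, -, rfl⟩ := h.good_cross hg hn (fun hh => hh ha' a.2)
    have a2 := a.2
    have b2 := b.2
    simp only [Set.mem_insert_iff, Set.mem_singleton_iff] at ha' hb'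
    grind
  have e : (Subtype.val '' (Subtype.val ⁻¹' B' : Set A) : Set V) = B' := by
    rw [Subtype.image_preimage_coe]
    exact Set.inter_eq_right.2 hBA
  rw [← e] at hg
  have := (isBlock_iff.1 hB.1).2 (Subtype.val ⁻¹' B') (fun x hx => hs ⟨x, hx, rfl⟩)
    (hg.iso (isoSub G A _).symm)
  rw [← this, e]

lemma Cut1.nblocks {V : Type} [Finite V] {G : SimpleGraph V} {A : Set V} (h : Cut1 G A) :
    NBlocks G = ((fun B : Set A => (Subtype.val '' B : Set V)) '' NBlocks (G.induce A) ∪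
      (fun B : Set (Aᶜ : Set V) => (Subtype.val '' B : Set V)) '' NBlocks (G.induce Aᶜ)) ∪
      {B | ∃ x ∈ A, ∃ y ∉ A, G.Adj x y ∧ B = {x, y}} := by
  ext B
  constructor
  · intro hB
    by_cases h1 : B ⊆ A
    · exact Or.inl (Or.inl (block_down hB h1))
    by_cases h2 : B ⊆ Aᶜ
    · exact Or.inl (Or.inr (block_down hB h2))
    exact Or.inr (h.good_cross hB.1.1 h1 h2)
  · rintro ((⟨B, hB, rfl⟩ | ⟨B, hB, rfl⟩) | ⟨x, hx, y, hy, hxy, rfl⟩)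
    · exact h.block_up hB
    · exact h.compl.block_up hB
    · refine ⟨isBlock_iff.2 ⟨good_induce_pair hxy, ?_⟩, Set.nontrivial_pair hxy.ne⟩
      intro B' hs hg
      have hxB : x ∈ B' := hs (by simp)
      have hyB : y ∈ B' := hs (by simp)
      obtain ⟨x', hx', y', hy', hxy', rfl⟩ := h.good_cross hg (fun hh => hy (hh hyB))
        (fun hh => hh hxB hx)
      obtain ⟨rfl, rfl⟩ := h x hx y hy x' hx' y' hy' hxy hxy'
      rfl

lemma Cut1.rg {V : Type} [Finite V] {G : SimpleGraph V} {A : Set V} (h : Cut1 G A) (g : ℕ) :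
    rg g G = rg g (G.induce A) + rg g (G.induce Aᶜ) +
      ∑ᶠ B ∈ {B | ∃ x ∈ A, ∃ y ∉ A, G.Adj x y ∧ B = {x, y}}, eps g (G.induce B) := by
  have key : ∀ A : Set V, ∀ B ∈ (fun B : Set A => (Subtype.val '' B : Set V)) ''
      NBlocks (G.induce A), B ⊆ A ∧ B.Nonempty := by
    rintro A _ ⟨B, hB, rfl⟩
    refine ⟨?_, hB.2.nonempty.image _⟩
    rintro _ ⟨x, -, rfl⟩
    exact x.2
  have im : ∀ A : Set V, ∑ᶠ B ∈ (fun B : Set A => (Subtype.val '' B : Set V)) ''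
      NBlocks (G.induce A), eps g (G.induce B) = InducedForest.rg g (G.induce A) := by
    intro A
    rw [rg_eq, finsum_mem_image (Subtype.val_injective.image_injective.injOn)]
    refine finsum_mem_congr rfl fun B _ => ?_
    exact (eps_iso g (isoSub G A B)).symm
  rw [rg_eq g G, h.nblocks, finsum_mem_union _ (Set.toFinite _) (Set.toFinite _),
    finsum_mem_union _ (Set.toFinite _) (Set.toFinite _), im, im]
  · rw [Set.disjoint_left]
    intro B h1 h2
    obtain ⟨k1, b, hb⟩ := key _ _ h1
    obtain ⟨k2, -⟩ := key _ _ h2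
    exact k2 hb (k1 hb)
  · rw [Set.disjoint_left]
    rintro B (h1 | h1) ⟨x, hx, y, hy, hxy, rfl⟩
    · exact hy ((key _ _ h1).1 (by simp))
    · exact (key _ _ h1).1 (Set.mem_insert x _) hx

/-! ### Existence of the cut -/

lemma not_connected_cut {V : Type} [Nonempty V] {G : SimpleGraph V} (h : ¬ G.Connected) :
    ∃ A : Set V, A.Nonempty ∧ Aᶜ.Nonempty ∧ ∀ x ∈ A, ∀ y ∉ A, ¬ G.Adj x y := by
  have : ¬ G.Preconnected := fun hp => h ⟨hp⟩
  unfold Preconnected at this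
  push Not at this
  obtain ⟨u, v, huv⟩ := this
  exact ⟨{w | G.Reachable u w}, ⟨u, Reachable.refl _⟩, ⟨v, huv⟩,
    fun x hx y hy hxy => hy (Reachable.trans hx hxy.reachable)⟩

lemma exists_cut {V : Type} [Finite V] {G : SimpleGraph V} (hs : Subcubic G)
    (h2 : 2 ≤ Nat.card V) (h : ¬ TwoConnected G) :
    ∃ A : Set V, A.Nonempty ∧ Aᶜ.Nonempty ∧ Cut1 G A := by
  by_cases h3 : 3 ≤ Nat.card V
  · have : ∃ s : Set V, s.ncard < 2 ∧ ¬ (G.induce sᶜ).Connected := by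
      by_contra! hn
      exact h ⟨h3, hn⟩
    obtain ⟨s, hs2, hc⟩ := this
    have hne : Nonempty (sᶜ : Set V) := by
      have := Set.ncard_add_ncard_compl s
      have : 0 < sᶜ.ncard := by omega
      exact (Set.nonempty_of_ncard_ne_zero (by omega)).coe_sort
    obtain ⟨A, ⟨a, ha⟩, ⟨b, hb⟩, hA⟩ := not_connected_cut hc
    have hs1 : s = ∅ ∨ ∃ v, s = {v} := by
      have : s.ncard = 0 ∨ s.ncard = 1 := by omega
      rcases this with h0 | h0
      · exact Or.inl ((Set.ncard_eq_zero).1 h0)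
      · exact Or.inr (Set.ncard_eq_one.1 h0)
    let A1 : Set V := Subtype.val '' A
    let A2 : Set V := Subtype.val '' Aᶜ
    have hA1 : ∀ x, x ∈ A1 → x ∉ s := by rintro _ ⟨x, -, rfl⟩; exact x.2
    have hA2 : ∀ x, x ∈ A2 → x ∉ s := by rintro _ ⟨x, -, rfl⟩; exact x.2
    have hA12 : ∀ x ∈ A1, ∀ y ∈ A2, ¬ G.Adj x y := by
      rintro _ ⟨x, hx, rfl⟩ _ ⟨y, hy, rfl⟩ hxy
      exact hA x hx y hy hxy
    have hcov : ∀ x, x ∈ A1 ∨ x ∈ A2 ∨ x ∈ s := by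
      intro x
      by_cases hx : x ∈ s
      · exact Or.inr (Or.inr hx)
      by_cases hx' : (⟨x, hx⟩ : (sᶜ : Set V)) ∈ A
      · exact Or.inl ⟨_, hx', rfl⟩
      · exact Or.inr (Or.inl ⟨_, hx', rfl⟩)
    have hdis : ∀ x ∈ A1, x ∉ A2 := by
      rintro _ ⟨x, hx, rfl⟩ ⟨y, hy, hxy⟩
      exact hy (by rwa [Subtype.ext hxy])
    have ha1 : (a : V) ∈ A1 := ⟨a, ha, rfl⟩
    have hb2 : (b : V) ∈ A2 := ⟨b, hb, rfl⟩
    rcases hs1 with rfl | ⟨v, rfl⟩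
    · refine ⟨A1, ⟨a, ha1⟩, ⟨b, fun hh => hdis _ hh hb2⟩, ?_⟩
      intro x hx y hy x' hx' y' hy' hxy
      rcases hcov y with h | h | h
      · exact absurd h hy
      · exact absurd hxy (hA12 x hx y h)
      · exact absurd h (Set.notMem_empty _)
    · have hcard : (G.neighborSet v ∩ A1).ncard + (G.neighborSet v ∩ A2).ncard ≤ 3 := by
        rw [← Set.ncard_union_eq _ (Set.toFinite _) (Set.toFinite _)]
        · refine (Set.ncard_le_ncard ?_ (Set.toFinite _)).trans (hs v)
          rintro x (hx | hx) <;> exact hx.1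
        · rw [Set.disjoint_left]
          intro x h1 h2
          exact hdis x h1.2 h2.2
      have main : ∀ A1 A2 : Set V, (∀ x ∈ A1, ∀ y ∈ A2, ¬ G.Adj x y) →
          (∀ x, x ∈ A1 ∨ x ∈ A2 ∨ x = v) → (G.neighborSet v ∩ A1).ncard ≤ 1 → Cut1 G A1 := by
        intro A1 A2 hA12 hcov hc x hx y hy x' hx' y' hy' hxy hxy'
        have e1 : y = v := by
          rcases hcov y with h | h | h
          · exact absurd h hy
          · exact absurd hxy (hA12 x hx y h)
          · exact h
        have e2 : y' = v := by
          rcases hcov y' with h | h | h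
          · exact absurd h hy'
          · exact absurd hxy' (hA12 x' hx' y' h)
          · exact h
        subst e1
        subst e2
        refine ⟨?_, rfl⟩
        rw [Set.ncard_le_one_iff] at hc
        exact hc ⟨hxy.symm, hx⟩ ⟨hxy'.symm, hx'⟩
      rcases (by omega : (G.neighborSet v ∩ A1).ncard ≤ 1 ∨ (G.neighborSet v ∩ A2).ncard ≤ 1)
        with h1 | h1
      · exact ⟨A1, ⟨a, ha1⟩, ⟨b, fun hh => hdis _ hh hb2⟩, main A1 A2 hA12 hcov h1⟩
      · refine ⟨A2, ⟨b, hb2⟩, ⟨a, hdis _ ha1⟩, main A2 A1 ?_ ?_ h1⟩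
        · intro x hx y hy hxy
          exact hA12 y hy x hx hxy.symm
        · intro x
          have := hcov x
          simp only [Set.mem_singleton_iff] at this
          tauto
  · have hc : Nat.card V = 2 := by omega
    obtain ⟨u, v, huv, hu⟩ := Nat.card_eq_two_iff.1 hc
    have hall : ∀ w, w ≠ u → w = v := by
      intro w hw
      have : w ∈ ({u, v} : Set V) := hu ▸ Set.mem_univ w
      rcases this with h | h
      · exact absurd h hw
      · exact h
    refine ⟨{u}, ⟨u, rfl⟩, ⟨v, fun hh => huv hh.symm⟩, ?_⟩
    rintro x rfl y hy x' rfl y' hy' - -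
    exact ⟨rfl, (hall y hy).trans (hall y' hy').symm⟩

/-! ### Hereditary properties -/

lemma Subcubic.induce {V : Type} [Finite V] {G : SimpleGraph V} (h : Subcubic G) (A : Set V) :
    Subcubic (G.induce A) := by
  intro v
  refine le_trans ?_ (h v)
  rw [← Set.ncard_image_of_injective _ Subtype.val_injective]
  refine Set.ncard_le_ncard ?_ (Set.toFinite _)
  rintro _ ⟨x, hx, rfl⟩
  exact hx

lemma twoDisjoint_induce {V : Type} {G : SimpleGraph V} {A : Set V} {g : ℕ}
    (h : TwoDisjointCyclesLt (G.induce A) g) : TwoDisjointCyclesLt G g := by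
  obtain ⟨u, v, c1, c2, h1, h2, h3, h4, h5⟩ := h
  have hi : Function.Injective (Embedding.induce (G := G) A).toHom :=
    (Embedding.induce (G := G) A).injective
  refine ⟨_, _, c1.map (Embedding.induce A).toHom, c2.map (Embedding.induce A).toHom,
    h1.map hi, h2.map hi, by rwa [Walk.length_map], by rwa [Walk.length_map], ?_⟩
  intro x hx hx'
  rw [Walk.support_map, List.mem_map] at hx hx'
  obtain ⟨y, hy, rfl⟩ := hx
  obtain ⟨z, hz, hzy⟩ := hx'
  have := hi hzy
  subst this
  exact h5 _ hy hz

/-- every `g`-minimal graph is 2-connected. -/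
theorem statement17 (g : ℕ) (hg : g = 4 ∨ g = 5) {V : Type} [Fintype V]
    (G : SimpleGraph V) (hG : GMinimal g G) : TwoConnected G := by
  classical
  obtain ⟨hsub, hdis, hlt, hmin⟩ := hG
  by_contra hn
  by_cases h2 : 2 ≤ Nat.card V
  · obtain ⟨A, ⟨a, ha⟩, ⟨b, hb⟩, hcut⟩ := exists_cut hsub h2 hn
    have hside : ∀ B : Set V, (∃ x, x ∉ B) → (fvs (G.induce B) : ℝ) ≤
        tg g * (G.induce B).edgeSet.ncard + rg g (G.induce B) := by
      rintro B ⟨x, hx⟩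
      refine hmin B (G.induce B) ?_ (hsub.induce B) (fun h => hdis (twoDisjoint_induce h))
      exact Finite.card_subtype_lt hx
    have k1 := hside A ⟨b, hb⟩
    have k2 := hside Aᶜ ⟨a, fun h => h ha⟩
    have k3 : (fvs G : ℝ) ≤ fvs (G.induce A) + fvs (G.induce Aᶜ) := by
      exact_mod_cast hcut.fvs_le
    have k4 := hcut.rg g
    have ht : 0 < tg g := by
      unfold tg
      split_ifs <;> norm_num
    by_cases hx : ∃ x ∈ A, ∃ y ∉ A, G.Adj x y
    · obtain ⟨x, hx, y, hy, hxy⟩ := hx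
      have k5 := edges_add G A {s(x, y)} (by
        rintro e rfl
        exact ⟨x, hx, y, hy, hxy, rfl⟩)
      rw [Set.ncard_singleton] at k5
      have e : {B : Set V | ∃ x ∈ A, ∃ y ∉ A, G.Adj x y ∧ B = {x, y}} = {{x, y}} := by
        ext B
        constructor
        · rintro ⟨x', hx', y', hy', hxy', rfl⟩
          obtain ⟨rfl, rfl⟩ := hcut x hx y hy x' hx' y' hy' hxy hxy'
          rfl
        · rintro rfl
          exact ⟨x, hx, y, hy, hxy, rfl⟩
      have k7 : eps g (G.induce {x, y}) = -tg g := by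
        refine eps_K2 g (u := ⟨x, by simp⟩) (v := ⟨y, by simp⟩) hxy ?_
        rintro ⟨w, rfl | rfl⟩ <;> simp
      rw [e, finsum_mem_singleton, k7] at k4
      have k8 : ((G.induce A).edgeSet.ncard : ℝ) + (G.induce Aᶜ).edgeSet.ncard + 1 ≤
          G.edgeSet.ncard := by exact_mod_cast k5
      have := mul_le_mul_of_nonneg_left k8 ht.le
      linarith
    · have k5 := edges_add G A ∅ (by simp)
      have e : {B : Set V | ∃ x ∈ A, ∃ y ∉ A, G.Adj x y ∧ B = {x, y}} = ∅ := by
        ext B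
        constructor
        · rintro ⟨x, h1, y, h2, h3, -⟩
          exact absurd ⟨x, h1, y, h2, h3⟩ hx
        · rintro ⟨⟩
      rw [e, finsum_mem_empty] at k4
      rw [Set.ncard_empty] at k5
      have k8 : ((G.induce A).edgeSet.ncard : ℝ) + (G.induce Aᶜ).edgeSet.ncard + 0 ≤
          G.edgeSet.ncard := by exact_mod_cast k5
      have := mul_le_mul_of_nonneg_left k8 ht.le
      linarith
  · have hss : Subsingleton V := Finite.card_le_one_iff_subsingleton.1 (by omega)
    have h1 : fvs G = 0 := by
      have : IsFVS G ∅ := IsAcyclic.of_subsingleton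
      have := fvs_le this
      simpa using this
    have h3 : NBlocks G = ∅ := by
      ext B
      constructor
      · intro hB
        exact absurd (Set.subsingleton_of_subsingleton) (Set.not_subsingleton_iff.2 hB.2)
      · rintro ⟨⟩
    rw [rg_eq, h3, finsum_mem_empty, h1] at hlt
    have : (0 : ℝ) ≤ tg g * G.edgeSet.ncard := by
      refine mul_nonneg ?_ (Nat.cast_nonneg _)
      unfold tg
      split_ifs <;> norm_num
    push_cast at hlt
    linarith

end InducedForest
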